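/- In the constrained composition setup and the classification setup, with F = C_v = v_H ∘ ⋯ ∘ v_1, G = C_w = w_H ∘ ⋯ ∘ w_1, δ = δ(v, w) and K_H = (1 + K_max · d_max)^H, one has ‖L_F − L_G‖_{2,U} = √2 · ‖f_F − f_G‖_{2,U} ≤ √2 · K_H · ‖Ψ'‖_∞ · δ. -/

import Mathlib

open Set MeasureTheory

/-- The cube `[-1,1]^n` in `ℝ^n`. -/
def cube (n : ℕ) : Set (Fin n → ℝ) := Set.univ.pi fun _ => Set.Icc (-1 : ℝ) 1

/-- Iterated composition of the layer maps: `iterComp d v k = v_k ∘ ⋯ ∘ v_1` in the paper's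
1-indexed notation (0-indexed layers `h = 0, …, H-1` here). -/
def iterComp (d : ℕ → ℕ) (v : ∀ h : ℕ, (Fin (d h) → ℝ) → (Fin (d (h + 1)) → ℝ)) :
    ∀ k : ℕ, (Fin (d 0) → ℝ) → (Fin (d k) → ℝ)
  | 0 => fun t => t
  | k + 1 => fun t => v k (iterComp d v k t)

lemma convex_cube (n : ℕ) : Convex ℝ (cube n) :=
  convex_pi fun _ _ => convex_Icc _ _

lemma mem_cube_iff_abs_le {n : ℕ} {t : Fin n → ℝ} : t ∈ cube n ↔ ∀ i, |t i| ≤ 1 := by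
  simp only [cube, mem_univ_pi, mem_Icc, abs_le]

lemma zero_mem_cube (n : ℕ) : (0 : Fin n → ℝ) ∈ cube n := by
  simp [mem_cube_iff_abs_le]

/-- The operator norm of a functional for the sup norm is controlled by its coordinates. -/
lemma opNorm_le_of_abs_apply_single_le {n : ℕ} (L : (Fin n → ℝ) →L[ℝ] ℝ) {K : ℝ} (hK : 0 ≤ K)
    (h : ∀ j, |L (Pi.single j 1)| ≤ K) : ‖L‖ ≤ K * n := by
  refine L.opNorm_le_bound (by positivity) fun x => ?_
  have hx : L x = ∑ j, x j * L (Pi.single j 1) := by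
    conv_lhs => rw [pi_eq_sum_univ' x]
    simp [map_sum]
  calc ‖L x‖ ≤ ∑ j, ‖x j * L (Pi.single j 1)‖ := by rw [hx]; exact norm_sum_le _ _
    _ ≤ ∑ _j : Fin n, ‖x‖ * K := by
        refine Finset.sum_le_sum fun j _ => ?_
        rw [norm_mul]
        exact mul_le_mul (norm_le_pi_norm x j) (h j) (norm_nonneg _) (norm_nonneg _)
    _ = K * n * ‖x‖ := by simp; ring

/-- Bounded partial derivatives on the cube give a Lipschitz estimate in the sup norm. -/
lemma abs_sub_le_of_abs_partial_le_on_cube {n : ℕ} {f : (Fin n → ℝ) → ℝ} {K : ℝ} (hK : 0 ≤ K)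
    (hf : DifferentiableOn ℝ f (cube n))
    (h : ∀ j, ∀ t ∈ cube n, |fderivWithin ℝ f (cube n) t (Pi.single j 1)| ≤ K)
    {x y : Fin n → ℝ} (hx : x ∈ cube n) (hy : y ∈ cube n) :
    |f x - f y| ≤ K * n * ‖x - y‖ :=
  (convex_cube n).norm_image_sub_le_of_norm_fderivWithin_le hf
    (fun t ht => opNorm_le_of_abs_apply_single_le _ hK fun j => h j t ht) hy hx

lemma iterComp_mem_cube {H : ℕ} {d : ℕ → ℕ}
    {v : ∀ h : ℕ, (Fin (d h) → ℝ) → (Fin (d (h + 1)) → ℝ)}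
    (hv : ∀ h, h + 1 < H → ∀ i, ∀ t ∈ cube (d h), |v h t i| ≤ 1)
    {t : Fin (d 0) → ℝ} (ht : t ∈ cube (d 0)) :
    ∀ k, k < H → iterComp d v k t ∈ cube (d k)
  | 0, _ => ht
  | k + 1, hk => mem_cube_iff_abs_le.2 fun i =>
      hv k hk i _ (iterComp_mem_cube hv ht k (Nat.lt_of_succ_lt hk))

/-- Error propagation through a composition of Lipschitz layers. -/
lemma norm_iterComp_sub_iterComp_le {H : ℕ} {d : ℕ → ℕ} {dmax : ℕ}
    (hdmax : ∀ h, h < H → d h ≤ dmax) {K : ℝ} (hK : 0 ≤ K)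
    {v w : ∀ h : ℕ, (Fin (d h) → ℝ) → (Fin (d (h + 1)) → ℝ)}
    (hvval : ∀ h, h + 1 < H → ∀ i, ∀ t ∈ cube (d h), |v h t i| ≤ 1)
    (hwval : ∀ h, h + 1 < H → ∀ i, ∀ t ∈ cube (d h), |w h t i| ≤ 1)
    (hvdiff : ∀ h, 1 ≤ h → h < H → ∀ i, DifferentiableOn ℝ (fun t => v h t i) (cube (d h)))
    (hvderiv : ∀ h, 1 ≤ h → h < H → ∀ i j, ∀ t ∈ cube (d h),
      |fderivWithin ℝ (fun s => v h s i) (cube (d h)) t (Pi.single j 1)| ≤ K)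
    {δ : ℝ} (hδ0 : 0 ≤ δ)
    (hδ : ∀ h, h < H → ∀ i, ∀ t ∈ cube (d h), |v h t i - w h t i| ≤ δ)
    {t : Fin (d 0) → ℝ} (ht : t ∈ cube (d 0)) (k : ℕ) (hk : k ≤ H) :
    ‖iterComp d v k t - iterComp d w k t‖ ≤ (1 + K * dmax) ^ k * δ := by
  have hKd : 0 ≤ K * dmax := by positivity
  induction k with
  | zero => simpa [iterComp] using hδ0
  | succ k ih =>
    have hkH : k < H := hk
    have hx := iterComp_mem_cube hvval ht k hkH
    have hy := iterComp_mem_cube hwval ht k hkH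
    have ih := ih hkH.le
    refine (pi_norm_le_iff_of_nonneg (by positivity)).2 fun i => ?_
    have hlip : |v k (iterComp d v k t) i - v k (iterComp d w k t) i|
        ≤ K * dmax * ‖iterComp d v k t - iterComp d w k t‖ := by
      rcases Nat.eq_zero_or_pos k with rfl | hk0
      · simp [iterComp]
      · refine (abs_sub_le_of_abs_partial_le_on_cube hK (hvdiff k hk0 hkH i)
          (hvderiv k hk0 hkH i) hx hy).trans ?_
        gcongr
        exact_mod_cast hdmax k hkH
    have hpow : δ ≤ (1 + K * dmax) ^ k * δ :=
      le_mul_of_one_le_left hδ0 (one_le_pow₀ (by linarith))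
    calc |v k (iterComp d v k t) i - w k (iterComp d w k t) i|
        ≤ |v k (iterComp d v k t) i - v k (iterComp d w k t) i|
          + |v k (iterComp d w k t) i - w k (iterComp d w k t) i| := abs_sub_le _ _ _
      _ ≤ K * dmax * ((1 + K * dmax) ^ k * δ) + (1 + K * dmax) ^ k * δ :=
          add_le_add (hlip.trans (mul_le_mul_of_nonneg_left ih hKd))
            ((hδ k hkH i _ hy).trans hpow)
      _ = (1 + K * dmax) ^ (k + 1) * δ := by ring

/-- in the constrained composition and classification setups, with
`F = C_v`, `G = C_w`, `f_F = Ψ ∘ F`, `L_F(·,1) = f_F`, `L_F(·,0) = 1 - f_F`,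
one has `‖L_F - L_G‖_{2,U} = √2 ‖f_F - f_G‖_{2,U} ≤ √2 K_H ‖Ψ'‖_∞ δ`. -/
theorem stmt11
    (H : ℕ) (hH : 2 ≤ H)
    (d : ℕ → ℕ) (hd : ∀ h, h ≤ H → 0 < d h) (hdH : d H = 1)
    (dmax : ℕ) (hdmax : ∀ h, h < H → d h ≤ dmax)
    (Kmax : ℝ) (hKmax : 0 < Kmax)
    (v w : ∀ h : ℕ, (Fin (d h) → ℝ) → (Fin (d (h + 1)) → ℝ))
    (hvcont : ∀ h, h < H → ∀ i, ContinuousOn (fun t => v h t i) (cube (d h)))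
    (hwcont : ∀ h, h < H → ∀ i, ContinuousOn (fun t => w h t i) (cube (d h)))
    (hvval : ∀ h, h + 1 < H → ∀ i, ∀ t ∈ cube (d h), |v h t i| ≤ 1)
    (hwval : ∀ h, h + 1 < H → ∀ i, ∀ t ∈ cube (d h), |w h t i| ≤ 1)
    (hvsmooth : ∀ h, 1 ≤ h → h < H → ∀ i, ContDiffOn ℝ 1 (fun t => v h t i) (cube (d h)))
    (hwsmooth : ∀ h, 1 ≤ h → h < H → ∀ i, ContDiffOn ℝ 1 (fun t => w h t i) (cube (d h)))
    (hvderiv : ∀ h, 1 ≤ h → h < H → ∀ i j, ∀ t ∈ cube (d h),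
      |fderivWithin ℝ (fun s => v h s i) (cube (d h)) t (Pi.single j 1)| ≤ Kmax)
    (hwderiv : ∀ h, 1 ≤ h → h < H → ∀ i j, ∀ t ∈ cube (d h),
      |fderivWithin ℝ (fun s => w h s i) (cube (d h)) t (Pi.single j 1)| ≤ Kmax)
    (δ : ℝ) (hδ : ∀ h, h < H → ∀ i, ∀ t ∈ cube (d h), |v h t i - w h t i| ≤ δ)
    (Ψ : ℝ → ℝ) (hΨrange : ∀ x, Ψ x ∈ Set.Ioo (0 : ℝ) 1)
    (hΨdiff : Differentiable ℝ Ψ)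
    (MΨ : ℝ) (hMΨ : ∀ x, |deriv Ψ x| ≤ MΨ)
    (μ : Measure (Fin (d 0) → ℝ)) [IsProbabilityMeasure μ]
    (hμ : μ (cube (d 0))ᶜ = 0) :
    ∀ i : Fin (d H), ∀ F G : (Fin (d 0) → ℝ) → ℝ,
      (∀ t, F t = iterComp d v H t i) → (∀ t, G t = iterComp d w H t i) →
      Real.sqrt (∫ u, (((1 - Ψ (F u)) - (1 - Ψ (G u))) ^ 2 + (Ψ (F u) - Ψ (G u)) ^ 2) ∂μ)
          = Real.sqrt 2 * Real.sqrt (∫ u, (Ψ (F u) - Ψ (G u)) ^ 2 ∂μ) ∧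
        Real.sqrt (∫ u, (((1 - Ψ (F u)) - (1 - Ψ (G u))) ^ 2 + (Ψ (F u) - Ψ (G u)) ^ 2) ∂μ)
          ≤ Real.sqrt 2 * (1 + Kmax * dmax) ^ H * MΨ * δ := by
  intro i F G hF hG
  have hδ0 : 0 ≤ δ :=
    (abs_nonneg _).trans (hδ 0 (by omega) ⟨0, hd 1 (by omega)⟩ 0 (zero_mem_cube _))
  have hM0 : 0 ≤ MΨ := (abs_nonneg _).trans (hMΨ 0)
  set B : ℝ := (1 + Kmax * dmax) ^ H * MΨ * δ with hB
  have hB0 : 0 ≤ B := by positivity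
  have hbound : ∀ u ∈ cube (d 0), |Ψ (F u) - Ψ (G u)| ≤ B := by
    intro u hu
    have hΨ : |Ψ (F u) - Ψ (G u)| ≤ MΨ * |F u - G u| :=
      convex_univ.norm_image_sub_le_of_norm_deriv_le (fun x _ => hΨdiff x)
        (fun x _ => hMΨ x) (mem_univ _) (mem_univ _)
    have hFG : |F u - G u| ≤ (1 + Kmax * dmax) ^ H * δ := by
      rw [hF, hG]
      exact (norm_le_pi_norm (iterComp d v H u - iterComp d w H u) i).trans
        (norm_iterComp_sub_iterComp_le hdmax hKmax.le hvval hwval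
          (fun h h1 h2 j => (hvsmooth h h1 h2 j).differentiableOn one_ne_zero) hvderiv hδ0 hδ hu
          H le_rfl)
    calc |Ψ (F u) - Ψ (G u)| ≤ MΨ * ((1 + Kmax * dmax) ^ H * δ) :=
          hΨ.trans (mul_le_mul_of_nonneg_left hFG hM0)
      _ = B := by rw [hB]; ring
  have hae : ∀ᵐ u ∂μ, ‖(Ψ (F u) - Ψ (G u)) ^ 2‖ ≤ B ^ 2 := by
    filter_upwards [mem_ae_iff.2 hμ] with u hu
    rw [norm_pow]
    exact pow_le_pow_left₀ (norm_nonneg _) (hbound u hu) 2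
  have hint : ∫ u, (Ψ (F u) - Ψ (G u)) ^ 2 ∂μ ≤ B ^ 2 := by
    simpa using (le_abs_self _).trans (norm_integral_le_of_norm_le_const hae)
  have heq : Real.sqrt (∫ u, (((1 - Ψ (F u)) - (1 - Ψ (G u))) ^ 2 + (Ψ (F u) - Ψ (G u)) ^ 2) ∂μ)
      = Real.sqrt 2 * Real.sqrt (∫ u, (Ψ (F u) - Ψ (G u)) ^ 2 ∂μ) := by
    rw [← Real.sqrt_mul zero_le_two, ← integral_const_mul]
    congr 2
    ext u
    ring
  refine ⟨heq, ?_⟩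
  rw [heq]
  calc Real.sqrt 2 * Real.sqrt (∫ u, (Ψ (F u) - Ψ (G u)) ^ 2 ∂μ)
      ≤ Real.sqrt 2 * B :=
        mul_le_mul_of_nonneg_left (Real.sqrt_le_iff.2 ⟨hB0, hint⟩) (Real.sqrt_nonneg _)
    _ = Real.sqrt 2 * (1 + Kmax * dmax) ^ H * MΨ * δ := by rw [hB]; ring
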